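/- arXiv:0909.1866 — 2 statements merged into one kernel-verified Lean document; each statement's English description precedes it below -/
import Mathlib

section
/- Fix an integer k ≥ 4. Let X = {v_0, ..., v_{k−1}, u} with metric d defined by: d(v_i, v_j) = 1 if i − j ≡ ±1 (mod k), d(v_i, v_j) = 2 for all other pairs of distinct cycle vertices, and d(v_i, u) = 2 for every i. Then the tight span T(X), as a topological space with the topology induced by its metric, is not homeomorphic to any subset of the Euclidean plane ℝ²; that is, there is no topological embedding of T(X) into ℝ². -/
/-- The tight span of a set `Z` with distance function `d`. -/
def TightSpanD {Z : Type*} (d : Z → Z → ℝ) : Set (Z → ℝ) :=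
  {f | (∀ x y, d x y ≤ f x + f y) ∧ ∀ x, (⨅ y, (f x + f y - d x y)) = 0}

/-- Distances on the `k`-cycle: `1` between cyclically adjacent vertices,
`2` between distinct non-adjacent vertices, `0` on the diagonal. -/
def cycDist (k : ℕ) (i j : Fin k) : ℝ :=
  if i = j then 0
  else if (i.val + 1) % k = j.val ∨ (j.val + 1) % k = i.val then 1
  else 2

/-- The metric on the `k`-cycle together with one extra vertex at distance `2`
from every cycle vertex. -/
def clawCycle (k : ℕ) : (Fin k ⊕ Unit) → (Fin k ⊕ Unit) → ℝ
  | Sum.inl i, Sum.inl j => cycDist k i j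
  | Sum.inl _, Sum.inr _ => 2
  | Sum.inr _, Sum.inl _ => 2
  | Sum.inr _, Sum.inr _ => 0

open unitInterval

theorem aux_homotopy {A : Type*} [TopologicalSpace A] (H : I × A → ℂ) (hH : Continuous H)
    (h0 : ∀ p, H p ≠ 0)
    (hs : ∃ g : A → ℂ, Continuous g ∧ ∀ a, Complex.exp (g a) = H (0, a)) :
    ∃ g : A → ℂ, Continuous g ∧ ∀ a, Complex.exp (g a) = H (1, a) := by
  obtain ⟨g, hg, hgH⟩ := hs
  let H' : C(I × A, {z : ℂ // z ≠ 0}) := ⟨fun p => ⟨H p, h0 p⟩, by fun_prop⟩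
  have H0 : ∀ a, H' (0, a) =
      (fun z : ℂ ↦ (⟨_, z.exp_ne_zero⟩ : {z : ℂ // z ≠ 0})) ((⟨g, hg⟩ : C(A, ℂ)) a) := by
    intro a
    apply Subtype.ext
    exact (hgH a).symm
  refine ⟨fun a => Complex.isCoveringMap_exp.liftHomotopy H' ⟨g, hg⟩ H0 (1, a), ?_, ?_⟩
  · fun_prop
  · intro a
    have := congr_fun (Complex.isCoveringMap_exp.liftHomotopy_lifts H' ⟨g, hg⟩ H0) (1, a)
    exact congrArg Subtype.val this

theorem aux_odd {A : Type*} [TopologicalSpace A] [ConnectedSpace A] (τ : A → A)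
    (hτ : Continuous τ) (hττ : ∀ a, τ (τ a) = a) (g : A → ℂ) (hg : Continuous g)
    (hodd : ∀ a, Complex.exp (g (τ a)) = - Complex.exp (g a)) : False := by
  let h : A → ℂ := fun a => g (τ a) - g a
  have hexp : ∀ a, Complex.exp (h a) = -1 := by
    intro a
    simp only [h, Complex.exp_sub, hodd]
    rw [neg_div, div_self (Complex.exp_ne_zero _)]
  have hc : Continuous (fun a => (h a).im) := by fun_prop
  have hanti : ∀ a, (h (τ a)).im = - (h a).im := by
    intro a
    simp [h, hττ]
  obtain ⟨a₀⟩ : Nonempty A := inferInstance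
  have : (0 : ℝ) ∈ Set.range (fun a => (h a).im) := by
    apply mem_range_of_exists_le_of_exists_ge hc
    · rcases le_total (h a₀).im 0 with h1 | h1
      · exact ⟨a₀, h1⟩
      · exact ⟨τ a₀, by rw [hanti]; linarith⟩
    · rcases le_total (h a₀).im 0 with h1 | h1
      · exact ⟨τ a₀, by rw [hanti]; linarith⟩
      · exact ⟨a₀, h1⟩
  obtain ⟨a, ha⟩ := this
  have h1 := congrArg Complex.re (hexp a)
  simp only at ha
  rw [Complex.exp_re, ha] at h1
  simp at h1
  have := Real.exp_pos (h a).re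
  linarith

theorem aux_noembed {A T : Type*} [TopologicalSpace A] [ConnectedSpace A] [TopologicalSpace T]
    (τ : A → A) (hτ : Continuous τ) (hττ : ∀ a, τ (τ a) = a)
    (D : I × A → T) (hD : Continuous D) (r : I → T) (hr : Continuous r)
    (h0 : ∀ a, D (0, a) = r 0) (h1 : ∀ p, D p ≠ r 1) (h2 : ∀ a t, D (1, a) ≠ r t)
    (h3 : ∀ a t, D (1, a) ≠ D (t, τ a)) (F : T → ℂ) (hF : Continuous F)
    (hinj : Function.Injective F) : False := by
  have s1 := aux_homotopy (fun p : I × A => F (D p) - F (r 1)) (by fun_prop)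
    (fun p => sub_ne_zero.2 (fun h => h1 p (hinj h)))
    ⟨fun _ => Complex.log (F (r 0) - F (r 1)), continuous_const, fun a => by
      obtain ⟨a₀⟩ : Nonempty A := inferInstance
      rw [Complex.exp_log, h0]
      rw [← h0 a₀]
      exact sub_ne_zero.2 (fun h => h1 _ (hinj h))⟩
  have s2 := aux_homotopy (fun p : I × A => F (D (1, p.2)) - F (r (unitInterval.symm p.1))) (by fun_prop)
    (fun p => sub_ne_zero.2 (fun h => h2 _ _ (hinj h))) (by simpa using s1)
  have s3 := aux_homotopy (fun p : I × A => F (D (1, p.2)) - F (D (p.1, τ p.2))) (by fun_prop)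
    (fun p => sub_ne_zero.2 (fun h => h3 _ _ (hinj h))) (by simpa [h0] using s2)
  obtain ⟨g, hg, hgg⟩ := s3
  refine aux_odd τ hτ hττ g hg (fun a => ?_)
  rw [hgg, hgg]
  simp [hττ]

/-- explicit cyclic adjacency -/
def cadj (k : ℕ) (i j : Fin k) : Prop :=
  i.val + 1 = j.val ∨ j.val + 1 = i.val ∨ (i.val + 1 = k ∧ j.val = 0) ∨
    (j.val + 1 = k ∧ i.val = 0)

theorem cadj_iff (k : ℕ) (i j : Fin k) :
    ((i.val + 1) % k = j.val ∨ (j.val + 1) % k = i.val) ↔ cadj k i j := by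
  have key : ∀ i j : Fin k, (i.val + 1) % k = j.val ↔
      (i.val + 1 = j.val ∨ (i.val + 1 = k ∧ j.val = 0)) := by
    intro i j
    have hi := i.2
    have hj := j.2
    rcases Nat.lt_or_ge (i.val + 1) k with h | h
    · rw [Nat.mod_eq_of_lt h]; omega
    · have : i.val + 1 = k := by omega
      rw [this, Nat.mod_self]; omega
  rw [key, key, cadj]
  tauto

theorem cyc_cases (k : ℕ) (hk : 4 ≤ k) (i j : Fin k) :
    (i = j ∧ cycDist k i j = 0) ∨ (i ≠ j ∧ cadj k i j ∧ cycDist k i j = 1) ∨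
    (i ≠ j ∧ ¬ cadj k i j ∧ cycDist k i j = 2) := by
  unfold cycDist
  rw [← cadj_iff k]
  by_cases h : i = j
  · simp [h]
  · by_cases h' : ((i.val + 1) % k = j.val ∨ (j.val + 1) % k = i.val)
    · simp only [if_neg h, if_pos h']; tauto
    · simp only [if_neg h, if_neg h']; tauto

/-- far vertices -/
def cfar (k : ℕ) (i j : Fin k) : Prop := i ≠ j ∧ ¬ cadj k i j

theorem cfar_symm {k : ℕ} {i j : Fin k} (h : cfar k i j) : cfar k j i := by
  unfold cfar cadj at *
  refine ⟨h.1.symm, ?_⟩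
  have := h.2
  omega

/-- Hat functions. -/
noncomputable def hat (k : ℕ) (i : Fin k) (a : AddCircle (k : ℝ)) : ℝ :=
  max 0 (1 - ‖a - ((i.val : ℝ) : AddCircle (k : ℝ))‖)

theorem norm_int (k : ℕ) (i j : Fin k) : ∃ n : ℤ,
    ‖((i.val : ℝ) : AddCircle (k : ℝ)) - ((j.val : ℝ) : AddCircle (k : ℝ))‖ =
      |(((i.val : ℤ) - (j.val : ℤ) - n * (k : ℤ) : ℤ) : ℝ)| := by
  rw [← AddCircle.coe_sub, AddCircle.norm_eq]
  exact ⟨_, by push_cast; rfl⟩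

theorem mul_small (k : ℤ) (hk : 4 ≤ k) (n x : ℤ) (h1 : x - n * k ≤ 1) (h2 : -1 ≤ x - n * k)
    (h3 : -k < x) (h4 : x < k) : n = 0 ∨ n = 1 ∨ n = -1 := by
  have a : n < 2 := by by_contra h; nlinarith
  have b : -2 < n := by by_contra h; nlinarith
  omega

theorem norm_lt_two (k : ℕ) (hk : 4 ≤ k) (i j : Fin k)
    (h : ‖((i.val : ℝ) : AddCircle (k : ℝ)) - ((j.val : ℝ) : AddCircle (k : ℝ))‖ < 2) :
    ¬ cfar k i j := by
  obtain ⟨n, hn⟩ := norm_int k i j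
  rw [hn, ← Int.cast_abs] at h
  have h' : |(i.val : ℤ) - (j.val : ℤ) - n * (k : ℤ)| < 2 := by exact_mod_cast h
  rw [abs_lt] at h'
  have hi := i.2
  have hj := j.2
  have := mul_small k (by omega) n ((i.val : ℤ) - (j.val : ℤ)) (by omega) (by omega)
    (by omega) (by omega)
  unfold cfar cadj
  rw [Ne, Fin.ext_iff]
  rcases this with rfl | rfl | rfl <;> omega

theorem norm_ge_one (k : ℕ) (hk : 4 ≤ k) (i j : Fin k) (hij : i ≠ j) :
    1 ≤ ‖((i.val : ℝ) : AddCircle (k : ℝ)) - ((j.val : ℝ) : AddCircle (k : ℝ))‖ := by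
  obtain ⟨n, hn⟩ := norm_int k i j
  rw [hn, ← Int.cast_abs]
  suffices h : 1 ≤ |(i.val : ℤ) - (j.val : ℤ) - n * (k : ℤ)| by exact_mod_cast h
  by_contra h'
  have h' : |(i.val : ℤ) - (j.val : ℤ) - n * (k : ℤ)| < 1 := by omega
  rw [abs_lt] at h'
  have hi := i.2
  have hj := j.2
  have := mul_small k (by omega) n ((i.val : ℤ) - (j.val : ℤ)) (by omega) (by omega)
    (by omega) (by omega)
  rw [Ne, Fin.ext_iff] at hij
  rcases this with rfl | rfl | rfl <;> omega

section hats
variable {k : ℕ}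

theorem hat_cont (i : Fin k) : Continuous (hat k i) := by
  unfold hat; fun_prop

theorem hat_nonneg (i : Fin k) (a) : 0 ≤ hat k i a := le_max_left _ _

theorem hat_le_one (i : Fin k) (a) : hat k i a ≤ 1 := by
  unfold hat
  have := norm_nonneg (a - ((i.val : ℝ) : AddCircle (k : ℝ)))
  exact max_le (by norm_num) (by linarith)

theorem hat_pos_norm {i : Fin k} {a} (h : 0 < hat k i a) :
    ‖a - ((i.val : ℝ) : AddCircle (k : ℝ))‖ < 1 ∧
      hat k i a = 1 - ‖a - ((i.val : ℝ) : AddCircle (k : ℝ))‖ := by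
  unfold hat at *
  rcases lt_max_iff.1 h with h | h
  · exact absurd h (lt_irrefl _)
  · exact ⟨by linarith, max_eq_right h.le⟩

theorem tri (a b c : AddCircle (k : ℝ)) : ‖b - c‖ ≤ ‖a - b‖ + ‖a - c‖ := by
  have : b - c = (a - c) - (a - b) := by abel
  rw [this]
  linarith [norm_sub_le (a - c) (a - b)]

theorem hat_supp (hk : 4 ≤ k) {i j : Fin k} {a} (hi : 0 < hat k i a) (hj : 0 < hat k j a) :
    ¬ cfar k i j := by
  apply norm_lt_two k hk
  have := tri a ((i.val : ℝ) : AddCircle (k : ℝ)) ((j.val : ℝ) : AddCircle (k : ℝ))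
  linarith [(hat_pos_norm hi).1, (hat_pos_norm hj).1]

theorem hat_zero (hk : 4 ≤ k) {i j : Fin k} {a} (hi : 0 < hat k i a) (hf : cfar k i j) :
    hat k j a = 0 := by
  by_contra h
  exact hat_supp hk hi (lt_of_le_of_ne (hat_nonneg _ _) (Ne.symm h)) hf

theorem hat_sum (hk : 4 ≤ k) {i j : Fin k} (hij : i ≠ j) (a) : hat k i a + hat k j a ≤ 1 := by
  by_cases hi : 0 < hat k i a
  · by_cases hj : 0 < hat k j a
    · have := tri a ((i.val : ℝ) : AddCircle (k : ℝ)) ((j.val : ℝ) : AddCircle (k : ℝ))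
      rw [(hat_pos_norm hi).2, (hat_pos_norm hj).2]
      linarith [norm_ge_one k hk i j hij]
    · linarith [hat_le_one i a]
  · linarith [hat_le_one j a]

theorem hat_exists (hk : 4 ≤ k) (a : AddCircle (k : ℝ)) : ∃ i : Fin k, 0 < hat k i a := by
  have hk0 : (0 : ℝ) < k := by exact_mod_cast (by omega : 0 < k)
  haveI : Fact ((0 : ℝ) < k) := ⟨hk0⟩
  obtain ⟨x, hx, rfl⟩ : ∃ x ∈ Set.Ico (0 : ℝ) (0 + k), (x : AddCircle (k : ℝ)) = a := by
    have := AddCircle.coe_image_Ico_eq (k : ℝ) 0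
    have h2 : a ∈ (Set.univ : Set (AddCircle (k : ℝ))) := trivial
    rw [← this] at h2
    exact h2
  have hfl : Nat.floor x < k := by
    rw [Nat.floor_lt hx.1]; linarith [hx.2]
  refine ⟨⟨Nat.floor x, hfl⟩, ?_⟩
  unfold hat
  apply lt_max_of_lt_right
  have h1 := Nat.floor_le hx.1
  have h2 := Nat.lt_floor_add_one x
  have h3 : |x - (⌊x⌋₊ : ℝ)| < 1 := by rw [abs_lt]; constructor <;> linarith
  have h4 : ‖((x - (⌊x⌋₊ : ℝ) : ℝ) : AddCircle (k : ℝ))‖ = |x - (⌊x⌋₊ : ℝ)| := by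
    have hk4 : (4 : ℝ) ≤ k := by exact_mod_cast hk
    rw [AddCircle.norm_coe_eq_abs_iff _ hk0.ne', abs_of_pos hk0]
    linarith
  rw [← AddCircle.coe_sub, h4]
  linarith

theorem hat_anti (hk : 4 ≤ k) {i : Fin k} {a : AddCircle (k : ℝ)} (h : 0 < hat k i a) :
    hat k i (a + (((k : ℝ) / 2 : ℝ) : AddCircle (k : ℝ))) = 0 := by
  have hk0 : (4 : ℝ) ≤ k := by exact_mod_cast hk
  have hn : ‖(((k : ℝ) / 2 : ℝ) : AddCircle (k : ℝ))‖ = k / 2 := by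
    rw [AddCircle.norm_half_period_eq, abs_of_pos (by linarith)]
  unfold hat
  apply max_eq_left
  have h1 := (hat_pos_norm h).1
  have : (((k : ℝ) / 2 : ℝ) : AddCircle (k : ℝ)) =
    (a + (((k : ℝ) / 2 : ℝ) : AddCircle (k : ℝ)) - ((i.val : ℝ) : AddCircle (k : ℝ))) -
      (a - ((i.val : ℝ) : AddCircle (k : ℝ))) := by abel
  have h2 := norm_sub_le
    (a + (((k : ℝ) / 2 : ℝ) : AddCircle (k : ℝ)) - ((i.val : ℝ) : AddCircle (k : ℝ)))
      (a - ((i.val : ℝ) : AddCircle (k : ℝ)))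
  rw [← this, hn] at h2
  linarith

open Classical in
/-- sup of hats over far vertices -/
noncomputable def farSup (k : ℕ) (j : Fin k) (a : AddCircle (k : ℝ)) : ℝ :=
  ‖(fun i : Fin k => if cfar k j i then hat k i a else 0)‖

/-- sup of all hats -/
noncomputable def allSup (k : ℕ) (a : AddCircle (k : ℝ)) : ℝ :=
  ‖(fun i : Fin k => hat k i a)‖

theorem farSup_cont (j : Fin k) : Continuous (farSup k j) := by
  unfold farSup
  refine Continuous.norm (continuous_pi fun i => ?_)
  split_ifs
  · exact hat_cont i
  · exact continuous_const

theorem allSup_cont : Continuous (allSup k) := by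
  unfold allSup
  exact Continuous.norm (continuous_pi fun i => hat_cont i)

theorem le_allSup (i : Fin k) (a) : hat k i a ≤ allSup k a := by
  have := norm_le_pi_norm (fun i : Fin k => hat k i a) i
  exact (le_abs_self _).trans this

theorem le_farSup {i j : Fin k} (h : cfar k j i) (a) : hat k i a ≤ farSup k j a := by
  classical
  have := norm_le_pi_norm (fun i : Fin k => if cfar k j i then hat k i a else 0) i
  simp only [if_pos h] at this
  unfold farSup
  refine (le_abs_self _).trans (this.trans (le_of_eq ?_))
  congr

theorem farSup_nonneg (j : Fin k) (a) : 0 ≤ farSup k j a := norm_nonneg _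

theorem farSup_le {j : Fin k} {a} {c : ℝ} (hc : 0 ≤ c) (h : ∀ i, cfar k j i → hat k i a ≤ c) :
    farSup k j a ≤ c := by
  unfold farSup
  rw [pi_norm_le_iff_of_nonneg hc]
  intro i
  split_ifs with hi
  · rw [Real.norm_of_nonneg (hat_nonneg _ _)]; exact h i hi
  · simpa using hc

theorem farSup_attain {j : Fin k} {a} (h : 0 < farSup k j a) :
    ∃ i, cfar k j i ∧ farSup k j a ≤ hat k i a := by
  by_contra hcon
  push Not at hcon
  have : farSup k j a < farSup k j a := by
    conv_lhs => unfold farSup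
    rw [pi_norm_lt_iff h]
    intro i
    split_ifs with hi
    · rw [Real.norm_of_nonneg (hat_nonneg _ _)]; exact hcon i hi
    · simpa using h
  exact lt_irrefl _ this

theorem allSup_attain (hk : 4 ≤ k) (a) : ∃ i, 0 < hat k i a ∧ allSup k a ≤ hat k i a := by
  obtain ⟨i₀, hi₀⟩ := hat_exists hk a
  have h : 0 < allSup k a := lt_of_lt_of_le hi₀ (le_allSup i₀ a)
  by_contra hcon
  push Not at hcon
  have : allSup k a < allSup k a := by
    conv_lhs => unfold allSup
    rw [pi_norm_lt_iff h]
    intro i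
    rw [Real.norm_of_nonneg (hat_nonneg _ _)]
    by_cases hi : 0 < hat k i a
    · exact hcon i hi
    · exact lt_of_le_of_lt (not_lt.1 hi) h
  exact lt_irrefl _ this

theorem farSup_zero (hk : 4 ≤ k) {j : Fin k} {a} (h : 0 < hat k j a) : farSup k j a = 0 :=
  le_antisymm (farSup_le le_rfl fun _ hi => (hat_zero hk h hi).le) (farSup_nonneg _ _)

/-- points of the disc -/
noncomputable def dpt (k : ℕ) (r : ℝ) (a : AddCircle (k : ℝ)) : Fin k ⊕ Unit → ℝ
  | Sum.inl j => 1 - r * hat k j a + r * farSup k j a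
  | Sum.inr _ => 1 + r * allSup k a

/-- points of the hair -/
def hpt (k : ℕ) (r : ℝ) : Fin k ⊕ Unit → ℝ
  | Sum.inl _ => 1 + r
  | Sum.inr _ => 1 - r

theorem mem_span {Z : Type*} [Finite Z] (d : Z → Z → ℝ) (f : Z → ℝ)
    (h1 : ∀ x y, d x y ≤ f x + f y) (h2 : ∀ x, ∃ y, f x + f y ≤ d x y) :
    f ∈ TightSpanD d := by
  refine ⟨h1, fun x => ?_⟩
  obtain ⟨y, hy⟩ := h2 x
  haveI : Nonempty Z := ⟨x⟩
  apply le_antisymm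
  · exact (ciInf_le (Set.finite_range _).bddBelow y).trans (by linarith)
  · exact le_ciInf fun y => by linarith [h1 x y]

theorem opp_exists (hk : 4 ≤ k) (j p : Fin k) (h : cadj k j p) :
    ∃ l, cfar k j l ∧ l ≠ p ∧ cadj k l p := by
  have hj := j.2
  have hp := p.2
  have mk : ∀ n, n < k → (n ≠ j.val ∧ ¬ (j.val + 1 = n ∨ n + 1 = j.val ∨ (j.val + 1 = k ∧ n = 0) ∨
    (n + 1 = k ∧ j.val = 0))) → (n + 1 = p.val ∨ p.val + 1 = n ∨ (n + 1 = k ∧ p.val = 0) ∨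
    (p.val + 1 = k ∧ n = 0)) → ∃ l, cfar k j l ∧ l ≠ p ∧ cadj k l p := by
    intro n hn h1 h2
    refine ⟨⟨n, hn⟩, ⟨?_, h1.2⟩, ?_, h2⟩
    · rw [Ne, Fin.ext_iff]; exact fun h => h1.1 h.symm
    · rw [Ne, Fin.ext_iff]; simp only; omega
  unfold cadj at h
  by_cases hc : j.val + 1 = p.val ∨ (j.val + 1 = k ∧ p.val = 0)
  · by_cases hp' : p.val + 1 = k
    · exact mk 0 (by omega) (by omega) (by omega)
    · exact mk (p.val + 1) (by omega) (by omega) (by omega)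
  · by_cases hp' : p.val = 0
    · exact mk (k - 1) (by omega) (by omega) (by omega)
    · exact mk (p.val - 1) (by omega) (by omega) (by omega)

theorem nbr_exists (hk : 4 ≤ k) (j : Fin k) : ∃ p, cadj k j p := by
  have hj := j.2
  by_cases h : j.val + 1 = k
  · exact ⟨⟨0, by omega⟩, Or.inr (Or.inr (Or.inl ⟨h, rfl⟩))⟩
  · exact ⟨⟨j.val + 1, by omega⟩, Or.inl rfl⟩

/-- two distinct neighbours of a vertex are far apart -/
theorem nbr_far (hk : 4 ≤ k) {j p q : Fin k} (hp : cadj k j p) (hq : cadj k j q) (hpq : p ≠ q) :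
    cfar k p q := by
  have := j.2
  have := p.2
  have := q.2
  refine ⟨hpq, ?_⟩
  rw [Ne, Fin.ext_iff] at hpq
  unfold cadj at *
  omega

/-- when nothing far is active, there is an opposite vertex -/
theorem opp_vertex (hk : 4 ≤ k) (j : Fin k) (a) (h : farSup k j a ≤ 0) :
    ∃ l, cfar k j l ∧ hat k l a = 0 ∧ farSup k l a ≤ hat k j a := by
  obtain ⟨p, hjp, hp⟩ : ∃ p, cadj k j p ∧ ∀ i, 0 < hat k i a → i = j ∨ i = p := by
    have key : ∀ i, 0 < hat k i a → i = j ∨ cadj k j i := by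
      intro i hi
      by_contra hcon
      push Not at hcon
      linarith [le_farSup (⟨hcon.1.symm, hcon.2⟩ : cfar k j i) a]
    by_cases hex : ∃ p, cadj k j p ∧ 0 < hat k p a
    · obtain ⟨p, hp1, hp2⟩ := hex
      refine ⟨p, hp1, fun i hi => ?_⟩
      rcases key i hi with h1 | h1
      · exact Or.inl h1
      · right
        by_contra hne
        exact hat_supp hk hi hp2 (nbr_far hk h1 hp1 hne)
    · push Not at hex
      obtain ⟨p, hp⟩ := nbr_exists hk j
      refine ⟨p, hp, fun i hi => ?_⟩
      rcases key i hi with h1 | h1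
      · exact Or.inl h1
      · exact absurd hi (not_lt.2 (hex i h1))
  obtain ⟨l, hl1, hl2, hl3⟩ := opp_exists hk j p hjp
  refine ⟨l, hl1, ?_, farSup_le (hat_nonneg _ _) fun i hi => ?_⟩
  · by_contra hne
    rcases hp l (lt_of_le_of_ne (hat_nonneg _ _) (Ne.symm hne)) with h1 | h1
    · exact hl1.1 h1.symm
    · exact hl2 h1
  · by_cases hpos : 0 < hat k i a
    · rcases hp i hpos with h1 | h1
      · rw [h1]
      · rw [h1] at hi; exact absurd hl3 hi.2
    · exact (not_lt.1 hpos).trans (hat_nonneg _ _)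

theorem cyc_far (hk : 4 ≤ k) {i j : Fin k} (h : cfar k i j) : cycDist k i j = 2 := by
  rcases cyc_cases k hk i j with h1 | h1 | h1
  · exact absurd h1.1 h.1
  · exact absurd h1.2.1 h.2
  · exact h1.2.2

theorem dpt_mem (hk : 4 ≤ k) (r : ℝ) (hr0 : 0 ≤ r) (hr1 : r ≤ 1) (a) :
    dpt k r a ∈ TightSpanD (clawCycle k) := by
  have hm : ∀ j, 0 ≤ r * farSup k j a := fun j => mul_nonneg hr0 (farSup_nonneg j a)
  have hA : 0 ≤ r * allSup k a := mul_nonneg hr0 (norm_nonneg _)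
  have hs1 : ∀ j, r * hat k j a ≤ 1 := fun j =>
    mul_le_one₀ hr1 (hat_nonneg _ _) (hat_le_one _ _)
  have hsA : ∀ j, r * hat k j a ≤ r * allSup k a := fun j =>
    mul_le_mul_of_nonneg_left (le_allSup _ _) hr0
  apply mem_span
  · rintro (i | u) (j | v)
    · simp only [clawCycle, dpt]
      rcases cyc_cases k hk i j with ⟨h1, h2⟩ | ⟨h1, h2, h3⟩ | ⟨h1, h2, h3⟩
      · rw [h2]; linarith [hm i, hm j, hs1 i, hs1 j]
      · rw [h3]
        have := hat_sum hk h1 a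
        have h5 : r * (hat k i a + hat k j a) ≤ 1 :=
          mul_le_one₀ hr1 (add_nonneg (hat_nonneg _ _) (hat_nonneg _ _)) this
        linarith [hm i, hm j]
      · rw [h3]
        have h4 := mul_le_mul_of_nonneg_left (le_farSup (⟨h1, h2⟩ : cfar k i j) a) hr0
        have h5 := mul_le_mul_of_nonneg_left (le_farSup (cfar_symm (⟨h1, h2⟩ : cfar k i j)) a) hr0
        linarith
    · simp only [clawCycle, dpt]; linarith [hm i, hsA i]
    · simp only [clawCycle, dpt]; linarith [hm j, hsA j]
    · simp only [clawCycle, dpt]; linarith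
  · rintro (j | u)
    · by_cases hj : farSup k j a ≤ 0
      · obtain ⟨l, h1, h2, h3⟩ := opp_vertex hk j a hj
        refine ⟨Sum.inl l, ?_⟩
        simp only [clawCycle, dpt]
        rw [cyc_far hk h1, h2]
        have h4 := mul_le_mul_of_nonneg_left hj hr0
        have h5 := mul_le_mul_of_nonneg_left h3 hr0
        linarith
      · obtain ⟨l, h1, h2⟩ := farSup_attain (not_le.1 hj)
        refine ⟨Sum.inl l, ?_⟩
        simp only [clawCycle, dpt]
        rw [cyc_far hk h1, farSup_zero hk (lt_of_lt_of_le (not_le.1 hj) h2)]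
        have h4 := mul_le_mul_of_nonneg_left h2 hr0
        have h5 := mul_nonneg hr0 (hat_nonneg j a)
        linarith
    · obtain ⟨l, h1, h2⟩ := allSup_attain hk a
      refine ⟨Sum.inl l, ?_⟩
      simp only [clawCycle, dpt]
      rw [farSup_zero hk h1]
      have h4 := mul_le_mul_of_nonneg_left h2 hr0
      linarith

theorem hpt_mem (hk : 4 ≤ k) (r : ℝ) (hr0 : 0 ≤ r) (hr1 : r ≤ 1) :
    hpt k r ∈ TightSpanD (clawCycle k) := by
  apply mem_span
  · rintro (i | u) (j | v)
    · simp only [clawCycle, hpt]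
      rcases cyc_cases k hk i j with ⟨h1, h2⟩ | ⟨h1, h2, h3⟩ | ⟨h1, h2, h3⟩ <;> linarith
    · simp only [clawCycle, hpt]; linarith
    · simp only [clawCycle, hpt]; linarith
    · simp only [clawCycle, hpt]; linarith
  · rintro (j | u)
    · refine ⟨Sum.inr (), ?_⟩
      simp only [clawCycle, hpt]; linarith
    · refine ⟨Sum.inl ⟨0, by omega⟩, ?_⟩
      simp only [clawCycle, hpt]; linarith

end hats

theorem stmt17 (k : ℕ) (hk : 4 ≤ k) :
    ¬ ∃ e : {f : (Fin k ⊕ Unit) → ℝ // f ∈ TightSpanD (clawCycle k)} → ℝ × ℝ,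
        Topology.IsEmbedding e := by
  rintro ⟨e, he⟩
  have hc := he.continuous
  refine aux_noembed (A := AddCircle (k : ℝ))
    (fun a => a + (((k : ℝ) / 2 : ℝ) : AddCircle (k : ℝ))) (by fun_prop) ?_
    (fun p => ⟨dpt k p.1 p.2, dpt_mem hk _ p.1.2.1 p.1.2.2 _⟩) ?_
    (fun t => ⟨hpt k t, hpt_mem hk _ t.2.1 t.2.2⟩) ?_ ?_ ?_ ?_ ?_
    (fun f => Complex.equivRealProdCLM.symm (e f)) (by fun_prop) ?_
  · intro a
    rw [add_assoc, ← AddCircle.coe_add, add_halves, AddCircle.coe_period, add_zero]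
  · refine Continuous.subtype_mk (continuous_pi ?_) _
    rintro (j | u)
    · have := hat_cont j
      have := farSup_cont j
      simp only [dpt]
      fun_prop
    · have := allSup_cont (k := k)
      simp only [dpt]
      fun_prop
  · refine Continuous.subtype_mk (continuous_pi ?_) _
    rintro (j | u)
    · simp only [hpt]
      fun_prop
    · simp only [hpt]
      fun_prop
  · intro a
    apply Subtype.ext
    funext x
    rcases x with j | u <;> simp [dpt, hpt]
  · intro p h
    have h1 := congrFun (congrArg Subtype.val h) (Sum.inr ())
    simp only [dpt, hpt, Set.Icc.coe_one] at h1
    have := mul_nonneg p.1.2.1 (norm_nonneg (fun i : Fin k => hat k i p.2))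
    unfold allSup at h1
    linarith
  · intro a t h
    have h1 := congrFun (congrArg Subtype.val h) (Sum.inr ())
    simp only [dpt, hpt, Set.Icc.coe_one] at h1
    obtain ⟨i, hi⟩ := hat_exists hk a
    have := le_allSup i a
    have := t.2.1
    linarith
  · intro a t h
    obtain ⟨i, hi⟩ := hat_exists hk a
    have h1 := congrFun (congrArg Subtype.val h) (Sum.inl i)
    simp only [dpt, Set.Icc.coe_one] at h1
    rw [hat_anti hk hi, farSup_zero hk hi] at h1
    have := mul_nonneg t.2.1
      (farSup_nonneg i (a + (((k : ℝ) / 2 : ℝ) : AddCircle (k : ℝ))))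
    linarith
  · exact fun x y h => he.injective (Complex.equivRealProdCLM.symm.injective h)
end

section
/- Fix an integer k ≥ 4. Let X = {v_0, ..., v_{k−1}, u} with metric d defined by: d(v_i, v_j) = 1 if i − j ≡ ±1 (mod k), d(v_i, v_j) = 2 for all other pairs of distinct cycle vertices, and d(v_i, u) = 2 for every i. Then for every point p ∈ X, the tight span T(X \ {p}) of the restricted metric space is homeomorphic to a subset of the Euclidean plane ℝ²; that is, there exists a topological embedding of T(X \ {p}) into ℝ². -/
lemma ts_partner {Z : Type*} [Finite Z] {d : Z → Z → ℝ} {f : Z → ℝ}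
    (hf : f ∈ TightSpanD d) (x : Z) : ∃ y, f x + f y = d x y := by
  haveI : Nonempty Z := ⟨x⟩
  obtain ⟨y, hy⟩ := exists_eq_ciInf_of_finite (f := fun y => f x + f y - d x y)
  refine ⟨y, ?_⟩
  have h := hf.2 x
  rw [← hy] at h
  linarith

lemma ts_iff {Z : Type*} [Finite Z] (d : Z → Z → ℝ) (f : Z → ℝ) :
    f ∈ TightSpanD d ↔ (∀ x y, d x y ≤ f x + f y) ∧ ∀ x, ∃ y, f x + f y = d x y := by
  constructor
  · intro hf
    exact ⟨hf.1, ts_partner hf⟩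
  · rintro ⟨h1, h2⟩
    refine ⟨h1, fun x => ?_⟩
    haveI : Nonempty Z := ⟨x⟩
    obtain ⟨y, hy⟩ := h2 x
    apply le_antisymm
    · have := ciInf_le (Set.finite_range (fun y => f x + f y - d x y)).bddBelow y
      linarith
    · apply le_ciInf
      intro z
      linarith [h1 x z]

lemma ts_compact {Z : Type*} [Finite Z] (d : Z → Z → ℝ) (h0 : ∀ x, d x x = 0)
    (h2 : ∀ x y, d x y ≤ 2) : IsCompact (TightSpanD d) := by
  have hc : IsClosed (TightSpanD d) := by
    have : TightSpanD d = (⋂ x, ⋂ y, {f : Z → ℝ | d x y ≤ f x + f y}) ∩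
        ⋂ x, ⋃ y, {f : Z → ℝ | f x + f y = d x y} := by
      ext f
      rw [ts_iff]
      simp
    rw [this]
    refine IsClosed.inter ?_ ?_
    · refine isClosed_iInter fun x => isClosed_iInter fun y => ?_
      exact isClosed_le (by fun_prop) (by fun_prop)
    · refine isClosed_iInter fun x => isClosed_iUnion_of_finite fun y => ?_
      exact isClosed_eq (by fun_prop) (by fun_prop)
  refine IsCompact.of_isClosed_subset
    (isCompact_univ_pi (fun _ : Z => isCompact_Icc (a := (0 : ℝ)) (b := 2))) hc ?_
  intro f hf x _
  have hn : ∀ x, 0 ≤ f x := fun x => by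
    have := hf.1 x x
    rw [h0] at this
    linarith
  obtain ⟨y, hy⟩ := ts_partner hf x
  exact ⟨hn x, by linarith [hn y, h2 x y]⟩

lemma ts_le {Z : Type*} [Finite Z] {d : Z → Z → ℝ} (h2 : ∀ x y, d x y ≤ 2) {f f' : Z → ℝ}
    (hf : f ∈ TightSpanD d) (hf' : f' ∈ TightSpanD d)
    (h : ∀ x, max (1 - f x) 0 = max (1 - f' x) 0) (z : Z) : f z ≤ f' z := by
  have key : ∀ x, f x < 1 ∨ f' x < 1 → f x = f' x := by
    intro x hx
    have := h x
    rcases hx with hx | hx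
    · rw [max_eq_left (by linarith)] at this
      rcases max_cases (1 - f' x) 0 with ⟨h1, _⟩ | ⟨h1, _⟩ <;> linarith
    · rw [max_eq_left (a := 1 - f' x) (by linarith)] at this
      rcases max_cases (1 - f x) 0 with ⟨h1, _⟩ | ⟨h1, _⟩ <;> linarith
  by_contra hlt
  push Not at hlt
  have h1 : 1 ≤ f' z := by
    by_contra hh
    push Not at hh
    linarith [key z (Or.inr hh)]
  obtain ⟨w, hw⟩ := ts_partner hf z
  have hw1 : f w < 1 := by linarith [h2 z w]
  have := key w (Or.inl hw1)
  linarith [hf'.1 z w]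

/-- Cyclic adjacency. -/
def cycAdj (k : ℕ) (i j : ℕ) : Prop := (i + 1) % k = j ∨ (j + 1) % k = i

/-- The fan vectors. -/
noncomputable def fanX (k j : ℕ) : ℝ := if j + 1 = k then -1 else 1
noncomputable def fanY (k j : ℕ) : ℝ := if j + 1 = k then -1 else j

lemma mod_succ_cases (k i : ℕ) (hi : i < k) :
    (i + 1 < k ∧ (i + 1) % k = i + 1) ∨ (i + 1 = k ∧ (i + 1) % k = 0) := by
  rcases Nat.lt_or_ge (i + 1) k with h | h
  · exact Or.inl ⟨h, Nat.mod_eq_of_lt h⟩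
  · have : i + 1 = k := by omega
    exact Or.inr ⟨this, by rw [this, Nat.mod_self]⟩

lemma supp_form (k : ℕ) (hk : 4 ≤ k) (g : Fin k → ℝ) (h0 : ∀ j, 0 ≤ g j)
    (hs : ∀ i j, 0 < g i → 0 < g j → i = j ∨ cycAdj k i j) :
    ∃ (i i' : Fin k) (a b : ℝ), ((i : ℕ) + 1) % k = i' ∧ 0 ≤ a ∧ 0 ≤ b ∧
      ∀ j, g j = (if j = i then a else 0) + (if j = i' then b else 0) := by
  have main : ∀ i i' : Fin k, ((i : ℕ) + 1) % k = i' → (∀ j, j ≠ i → j ≠ i' → ¬ 0 < g j) →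
      ∃ (i i' : Fin k) (a b : ℝ), ((i : ℕ) + 1) % k = i' ∧ 0 ≤ a ∧ 0 ≤ b ∧
      ∀ j, g j = (if j = i then a else 0) + (if j = i' then b else 0) := by
    intro i i' hi hz
    refine ⟨i, i', g i, g i', hi, h0 _, h0 _, fun j => ?_⟩
    have hne : i ≠ i' := by
      rintro rfl
      have := mod_succ_cases k i i.2
      omega
    by_cases h1 : j = i
    · subst h1; simp [hne]
    · by_cases h2 : j = i'
      · subst h2; simp [h1]
      · simp only [h1, h2, if_false, add_zero]
        exact le_antisymm (not_lt.1 (hz j h1 h2)) (h0 j)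
  by_cases hall : ∀ j, ¬ 0 < g j
  · exact main ⟨0, by omega⟩ ⟨1, by omega⟩ (Nat.mod_eq_of_lt (by omega : 0 + 1 < k)) (fun j _ _ => hall j)
  push Not at hall
  obtain ⟨i, hi⟩ := hall
  set i' : Fin k := ⟨(i + 1) % k, Nat.mod_lt _ (by omega)⟩ with hi'
  have hv : (i' : ℕ) = (i + 1) % k := rfl
  by_cases hp : 0 < g i'
  · refine main i i' rfl fun j hj hj' hpos => ?_
    have e1 := hs i j hi hpos
    have e2 := hs i' j hp hpos
    unfold cycAdj at e1 e2
    have m1 := mod_succ_cases k i i.2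
    have m2 := mod_succ_cases k j j.2
    have m3 := mod_succ_cases k i' i'.2
    rw [Ne, Fin.ext_iff] at hj hj'
    rw [Fin.ext_iff] at e1 e2
    omega
  · have : ∃ m : Fin k, ((m : ℕ) + 1) % k = i := by
      rcases Nat.eq_zero_or_pos (i : ℕ) with h | h
      · refine ⟨⟨k - 1, by omega⟩, ?_⟩
        have : k - 1 + 1 = k := by omega
        simp [this, h]
      · refine ⟨⟨i - 1, by omega⟩, ?_⟩
        have : (i : ℕ) - 1 + 1 = i := by omega
        simp [this, Nat.mod_eq_of_lt i.2]
    obtain ⟨m, hm⟩ := this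
    refine main m i hm fun j hj hj' hpos => ?_
    have e1 := hs i j hi hpos
    have hji : j ≠ i' := by rintro rfl; exact hp hpos
    unfold cycAdj at e1
    have m2 := mod_succ_cases k j j.2
    have m3 := mod_succ_cases k m m.2
    rw [Ne, Fin.ext_iff] at hj hj' hji
    rw [Fin.ext_iff] at e1
    omega

lemma fan_sum (k : ℕ) (g : Fin k → ℝ) (i i' : Fin k) (a b : ℝ) (w : ℕ → ℝ)
    (h : ∀ j, g j = (if j = i then a else 0) + (if j = i' then b else 0)) :
    ∑ j, g j * w j = a * w i + b * w i' := by
  simp only [h, add_mul, ite_mul, zero_mul, Finset.sum_add_distrib, Finset.sum_ite_eq',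
    Finset.sum_ite_eq, Finset.mem_univ, if_true]

/-- the numerical core, `i ≤ l`. -/
lemma fan_core (k : ℕ) (hk : 4 ≤ k) (i i' l l' : ℕ) (hi : i < k) (hl : l < k) (hil : i ≤ l)
    (hi' : (i + 1) % k = i') (hl' : (l + 1) % k = l') (a b c d : ℝ)
    (ha : 0 ≤ a) (hb : 0 ≤ b) (hc : 0 ≤ c) (hd : 0 ≤ d)
    (hx : a * fanX k i + b * fanX k i' = c * fanX k l + d * fanX k l')
    (hy : a * fanY k i + b * fanY k i' = c * fanY k l + d * fanY k l') :
    (i = l ∧ a = c ∧ b = d) ∨ (a = 0 ∧ d = 0 ∧ b = c ∧ (b = 0 ∨ i' = l)) ∨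
    (b = 0 ∧ c = 0 ∧ a = d ∧ (a = 0 ∨ l' = i)) := by
  have hkr : (4 : ℝ) ≤ k := by exact_mod_cast hk
  have m1 := mod_succ_cases k i hi
  have m2 := mod_succ_cases k l hl
  unfold fanX at hx
  unfold fanY at hy
  -- type of an index: 0 plain, 1 = k-2, 2 = k-1
  have t1 : (i + 2 < k ∧ i' = i + 1) ∨ (i + 2 = k ∧ i' = i + 1) ∨ (i + 1 = k ∧ i' = 0) := by omega
  have t2 : (l + 2 < k ∧ l' = l + 1) ∨ (l + 2 = k ∧ l' = l + 1) ∨ (l + 1 = k ∧ l' = 0) := by omega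
  clear m1 m2 hi' hl'
  rcases t1 with ⟨p, rfl⟩ | ⟨p, rfl⟩ | ⟨p, rfl⟩
  · have q1 : ¬ (i + 1 = k) := by omega
    have q2 : ¬ (i + 1 + 1 = k) := by omega
    simp only [q1, q2, if_false] at hx hy
    push_cast at hy
    rcases t2 with ⟨r, rfl⟩ | ⟨r, rfl⟩ | ⟨r, rfl⟩
    · have s1 : ¬ (l + 1 = k) := by omega
      have s2 : ¬ (l + 1 + 1 = k) := by omega
      simp only [s1, s2, if_false] at hx hy
      push_cast at hy
      rcases Nat.eq_or_lt_of_le hil with h | h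
      · left
        subst h
        have : b = d := by
          have : c = a + b - d := by linarith
          subst this
          linarith
        exact ⟨rfl, by linarith, this⟩
      · right; left
        have hr : (i : ℝ) + 1 ≤ l := by exact_mod_cast h
        have e : b = (a + b) * ((l : ℝ) - i) + d := by
          have : c = a + b - d := by linarith
          subst this
          linarith
        have e2 : (a + b) * 1 ≤ (a + b) * ((l : ℝ) - i) :=
          mul_le_mul_of_nonneg_left (by linarith) (by linarith)
        have ha0 : a = 0 := by linarith
        have hd0 : d = 0 := by linarith
        refine ⟨ha0, hd0, by linarith, ?_⟩
        subst ha0 hd0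
        by_cases hb0 : b = 0
        · exact Or.inl hb0
        · right
          have : b * ((l : ℝ) - i - 1) = 0 := by linarith
          rcases mul_eq_zero.1 this with h' | h'
          · exact absurd h' hb0
          · have : (i : ℝ) + 1 = l := by linarith
            exact_mod_cast this
    · have s1 : ¬ (l + 1 = k) := by omega
      have s2 : (l + 1 + 1 = k) := by omega
      simp only [s1, s2, if_false, if_true] at hx hy
      have hlr : (l : ℝ) + 2 = k := by exact_mod_cast r
      have hr : (i : ℝ) + 1 ≤ l := by
        have : i + 1 ≤ l := by omega
        exact_mod_cast this
      have hi0 : (0 : ℝ) ≤ i := Nat.cast_nonneg i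
      have hce : c = a + b + d := by linarith
      subst hce
      have e1 : a * ((l : ℝ) - i) + b * ((l : ℝ) - i - 1) + d * ((l : ℝ) - 1) = 0 := by linarith
      have f1 : 0 ≤ a * ((l : ℝ) - i - 1) := mul_nonneg ha (by linarith)
      have f2 : 0 ≤ b * ((l : ℝ) - i - 1) := mul_nonneg hb (by linarith)
      have f3 : 0 ≤ d * ((l : ℝ) - 2) := mul_nonneg hd (by linarith)
      have ha0 : a = 0 := by linarith
      have hd0 : d = 0 := by linarith
      subst ha0 hd0
      right; left
      refine ⟨rfl, rfl, by ring, ?_⟩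
      have : b * ((l : ℝ) - i - 1) = 0 := by linarith
      rcases mul_eq_zero.1 this with h' | h'
      · exact Or.inl h'
      · right
        have : (i : ℝ) + 1 = l := by linarith
        exact_mod_cast this
    · have s2 : ¬ (0 + 1 = k) := by omega
      simp only [r, s2, if_false, if_true] at hx hy
      push_cast at hy
      have hi0 : (0 : ℝ) ≤ i := Nat.cast_nonneg i
      have f1 : 0 ≤ a * (i : ℝ) := mul_nonneg ha hi0
      have f2 : 0 ≤ b * (i : ℝ) := mul_nonneg hb hi0
      have hc0 : c = 0 := by linarith
      have hb0 : b = 0 := by linarith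
      subst hc0 hb0
      right; right
      refine ⟨rfl, rfl, by linarith, ?_⟩
      have : a * (i : ℝ) = 0 := by linarith
      rcases mul_eq_zero.1 this with h' | h'
      · exact Or.inl h'
      · right
        have : i = 0 := by exact_mod_cast h'
        exact this.symm
  · have q1 : ¬ (i + 1 = k) := by omega
    have q2 : (i + 1 + 1 = k) := by omega
    simp only [q1, q2, if_false, if_true] at hx hy
    have hir : (i : ℝ) + 2 = k := by exact_mod_cast p
    rcases t2 with ⟨r, rfl⟩ | ⟨r, rfl⟩ | ⟨r, rfl⟩
    · omega
    · have : i = l := by omega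
      subst this
      simp only [q1, q2, if_false, if_true] at hx hy
      left
      have hce : c = a - b + d := by linarith
      subst hce
      have : (b - d) * ((i : ℝ) - 1) = 0 := by linarith
      rcases mul_eq_zero.1 this with h' | h'
      · exact ⟨rfl, by linarith, by linarith⟩
      · linarith
    · have s2 : ¬ (0 + 1 = k) := by omega
      simp only [r, s2, if_false, if_true] at hx hy
      push_cast at hy
      have hce : c = b - a * i := by linarith
      subst hce
      have f : 0 ≤ a * ((i : ℝ) - 2) := mul_nonneg ha (by linarith)
      have ha0 : a = 0 := by linarith
      subst ha0
      right; left
      refine ⟨rfl, by linarith, by ring, Or.inr (by omega)⟩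
  · rcases t2 with ⟨r, rfl⟩ | ⟨r, rfl⟩ | ⟨r, rfl⟩
    · omega
    · omega
    · have : i = l := by omega
      subst this
      have s2 : ¬ (0 + 1 = k) := by omega
      simp only [p, s2, if_false, if_true] at hx hy
      push_cast at hy
      left
      exact ⟨rfl, by linarith, by linarith⟩

lemma fan_inj (k : ℕ) (hk : 4 ≤ k) (g g' : Fin k → ℝ) (h0 : ∀ j, 0 ≤ g j) (h0' : ∀ j, 0 ≤ g' j)
    (hs : ∀ i j, 0 < g i → 0 < g j → i = j ∨ cycAdj k i j)
    (hs' : ∀ i j, 0 < g' i → 0 < g' j → i = j ∨ cycAdj k i j)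
    (hx : ∑ j, g j * fanX k j = ∑ j, g' j * fanX k j)
    (hy : ∑ j, g j * fanY k j = ∑ j, g' j * fanY k j) : g = g' := by
  obtain ⟨i, i', a, b, hi, ha, hb, hg⟩ := supp_form k hk g h0 hs
  obtain ⟨l, l', c, d, hl, hc, hd, hg'⟩ := supp_form k hk g' h0' hs'
  rw [fan_sum k g i i' a b _ hg, fan_sum k g' l l' c d _ hg'] at hx hy
  have key : ((i : ℕ) = l ∧ a = c ∧ b = d) ∨ (a = 0 ∧ d = 0 ∧ b = c ∧ (b = 0 ∨ (i' : ℕ) = l)) ∨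
    (b = 0 ∧ c = 0 ∧ a = d ∧ (a = 0 ∨ (l' : ℕ) = i)) := by
    rcases le_total (i : ℕ) l with h | h
    · exact fan_core k hk i i' l l' i.2 l.2 h hi hl a b c d ha hb hc hd hx hy
    · rcases fan_core k hk l l' i i' l.2 i.2 h hl hi c d a b hc hd ha hb hx.symm hy.symm with
        ⟨h1, h2, h3⟩ | ⟨h1, h2, h3, h4⟩ | ⟨h1, h2, h3, h4⟩
      · exact Or.inl ⟨h1.symm, h2.symm, h3.symm⟩
      · exact Or.inr (Or.inr ⟨h2, h1, h3.symm, by rw [← h3]; exact h4⟩)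
      · exact Or.inr (Or.inl ⟨h2, h1, h3.symm, by rw [← h3]; exact h4⟩)
  funext j
  rw [hg, hg']
  rcases key with ⟨h1, h2, h3⟩ | ⟨h1, h2, h3, h4⟩ | ⟨h1, h2, h3, h4⟩
  · have hil : i = l := Fin.ext h1
    subst hil
    have : i' = l' := Fin.ext (by omega)
    subst this h2 h3
    rfl
  · subst h1 h2 h3
    rcases h4 with h4 | h4
    · simp [h4]
    · have : i' = l := Fin.ext h4
      simp [this]
  · subst h1 h2 h3
    rcases h4 with h4 | h4
    · simp [h4]
    · have : l' = i := Fin.ext h4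
      simp [this]

lemma emb_general (k : ℕ) (hk : 4 ≤ k) {Z : Type*} [Finite Z] (d : Z → Z → ℝ)
    (h0 : ∀ x, d x x = 0) (h2 : ∀ x y, d x y ≤ 2) (ψ : Fin k → Z) (hψ : Function.Surjective ψ)
    (hadj : ∀ i j, d (ψ i) (ψ j) < 2 → i = j ∨ cycAdj k i j) :
    ∃ e : {f : Z → ℝ // f ∈ TightSpanD d} → ℝ × ℝ, Topology.IsEmbedding e := by
  haveI : CompactSpace {f : Z → ℝ // f ∈ TightSpanD d} :=
    isCompact_iff_compactSpace.1 (ts_compact d h0 h2)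
  let e : {f : Z → ℝ // f ∈ TightSpanD d} → ℝ × ℝ := fun f =>
    (∑ j : Fin k, max (1 - f.1 (ψ j)) 0 * fanX k j, ∑ j : Fin k, max (1 - f.1 (ψ j)) 0 * fanY k j)
  refine ⟨e, (Continuous.isClosedEmbedding ?_ ?_).isEmbedding⟩
  · have : ∀ z : Z, Continuous fun f : {f : Z → ℝ // f ∈ TightSpanD d} => f.1 z :=
      fun z => (continuous_apply z).comp continuous_subtype_val
    have h' : ∀ z : Z, Continuous fun f : {f : Z → ℝ // f ∈ TightSpanD d} => max (1 - f.1 z) 0 :=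
      fun z => (continuous_const.sub (this z)).max continuous_const
    exact (continuous_finsetSum _ fun j _ => (h' (ψ j)).mul continuous_const).prodMk
      (continuous_finsetSum _ fun j _ => (h' (ψ j)).mul continuous_const)
  · have hs : ∀ f ∈ TightSpanD d, ∀ i j, 0 < max (1 - f (ψ i)) 0 → 0 < max (1 - f (ψ j)) 0 →
        i = j ∨ cycAdj k i j := by
      intro f hf i j hi hj
      simp only [lt_max_iff, lt_irrefl, or_false] at hi hj
      exact hadj i j (by linarith [hf.1 (ψ i) (ψ j)])
    rintro ⟨f, hf⟩ ⟨f', hf'⟩ hff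
    have hE := Prod.ext_iff.1 hff
    have := fan_inj k hk (fun j => max (1 - f (ψ j)) 0) (fun j => max (1 - f' (ψ j)) 0)
      (fun j => le_max_right _ _) (fun j => le_max_right _ _) (hs f hf) (hs f' hf') hE.1 hE.2
    have hg : ∀ x, max (1 - f x) 0 = max (1 - f' x) 0 := by
      intro x
      obtain ⟨j, rfl⟩ := hψ x
      exact congrFun this j
    apply Subtype.ext
    funext z
    exact le_antisymm (ts_le h2 hf hf' hg z) (ts_le h2 hf' hf (fun x => (hg x).symm) z)

lemma cycDist_le (k : ℕ) (i j : Fin k) : cycDist k i j ≤ 2 := by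
  unfold cycDist; split_ifs <;> norm_num

lemma cycDist_lt (k : ℕ) (i j : Fin k) (h : cycDist k i j < 2) : i = j ∨ cycAdj k i j := by
  unfold cycDist at h
  unfold cycAdj
  split_ifs at h with h1 h2
  · exact Or.inl h1
  · exact Or.inr h2
  · exact absurd h (lt_irrefl _)

theorem stmt18 (k : ℕ) (hk : 4 ≤ k) (p : Fin k ⊕ Unit) :
    ∃ e : {f : {w : Fin k ⊕ Unit // w ≠ p} → ℝ //
            f ∈ TightSpanD (fun a b : {w : Fin k ⊕ Unit // w ≠ p} =>
              clawCycle k a.val b.val)} → ℝ × ℝ,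
      Topology.IsEmbedding e := by
  have h0 : ∀ x : {w : Fin k ⊕ Unit // w ≠ p}, clawCycle k x.val x.val = 0 := by
    rintro ⟨x | x, hx⟩
    · simp [clawCycle, cycDist]
    · simp [clawCycle]
  have h2 : ∀ x y : {w : Fin k ⊕ Unit // w ≠ p}, clawCycle k x.val y.val ≤ 2 := by
    rintro ⟨x | x, hx⟩ ⟨y | y, hy⟩
    · exact cycDist_le k x y
    · simp [clawCycle]
    · simp [clawCycle]
    · simp [clawCycle]
  rcases p with i | u
  · refine emb_general k hk _ h0 h2
      (fun j => if h : j = i then ⟨Sum.inr (), by simp⟩ else ⟨Sum.inl j, by simpa using h⟩) ?_ ?_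
    · rintro ⟨x | x, hx⟩
      · have : x ≠ i := by simpa using hx
        exact ⟨x, by simp [this]⟩
      · exact ⟨i, by simp⟩
    · intro a b hab
      by_cases ha : a = i <;> by_cases hb : b = i
      · exact Or.inl (ha.trans hb.symm)
      · simp [ha, hb, clawCycle] at hab
      · simp [ha, hb, clawCycle] at hab
      · simp only [ha, hb, dite_false, clawCycle] at hab
        exact cycDist_lt k a b hab
  · refine emb_general k hk _ h0 h2 (fun j => ⟨Sum.inl j, by simp⟩) ?_ ?_
    · rintro ⟨x | x, hx⟩
      · exact ⟨x, rfl⟩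
      · exact absurd rfl hx
    · intro a b hab
      exact cycDist_lt k a b hab
end
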